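/- Let G be a finite simple graph and let v be a vertex of G of degree at most 2. Then G has a feedback vertex set of minimum cardinality that does not contain v. -/

import Mathlib

namespace SimpleGraph

variable {V : Type*} {G : SimpleGraph V}

/-- An induced subgraph is acyclic iff every cycle of the ambient graph leaves its vertex set. -/
theorem isAcyclic_induce_iff {s : Set V} :
    (G.induce s).IsAcyclic ↔
      ∀ ⦃u : V⦄ (c : G.Walk u u), c.IsCycle → ∃ x ∈ c.support, x ∉ s := by
  constructor
  · intro h u c hc
    by_contra! hs
    refine h (c.induce s hs) ?_
    rw [← Walk.isCycle_map_iff_of_injective (f := (Embedding.induce s).toHom)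
      Subtype.val_injective, Walk.map_induce]
    exact hc
  · intro h u c hc
    obtain ⟨x, hx, hxs⟩ := h (c.map (Embedding.induce s).toHom)
      ((Walk.isCycle_map_iff_of_injective Subtype.val_injective).2 hc)
    rw [Walk.support_map, List.mem_map] at hx
    obtain ⟨y, -, rfl⟩ := hx
    exact hxs y.2

/-- Every vertex of a cycle has two distinct neighbors on the cycle. -/
theorem Walk.IsCycle.exists_adj_ne_of_mem_support [DecidableEq V] {u v : V} {c : G.Walk u u}
    (hc : c.IsCycle) (hv : v ∈ c.support) :
    ∃ a ∈ c.support, ∃ b ∈ c.support, G.Adj v a ∧ G.Adj v b ∧ a ≠ b := by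
  have hr := hc.rotate hv
  have hmem : ∀ n, (c.rotate v hv).getVert n ∈ c.support := fun n ↦
    (Walk.mem_support_rotate_iff c v hv).1 (Walk.getVert_mem_support _ n)
  exact ⟨_, hmem _, _, hmem _,
    Walk.adj_snd hr.not_nil, (Walk.adj_penultimate hr.not_nil).symm, hr.snd_ne_penultimate⟩

/-- A vertex of degree at most 2 in a feedback vertex set can be dropped or exchanged for another
vertex. -/
theorem exists_isAcyclic_induce_compl_notMem [Fintype V] [DecidableEq V] [DecidableRel G.Adj]
    {v : V} (hv : G.degree v ≤ 2) {S : Finset V} (hS : (G.induce ((↑S : Set V)ᶜ)).IsAcyclic) :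
    ∃ T : Finset V, (G.induce ((↑T : Set V)ᶜ)).IsAcyclic ∧ T.card ≤ S.card ∧ v ∉ T := by
  by_cases hvS : v ∈ S
  swap
  · exact ⟨S, hS, le_rfl, hvS⟩
  rw [isAcyclic_induce_iff] at hS
  by_cases hw : ∃ w, G.Adj v w ∧ w ∉ S
  · obtain ⟨w, hvw, hwS⟩ := hw
    refine ⟨insert w (S.erase v), ?_, ?_, by simp [hvw.ne]⟩
    · rw [isAcyclic_induce_iff]
      intro u c hc
      by_contra! hcT
      obtain ⟨x, hx, hxS⟩ := hS c hc
      have hxv : x = v := by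
        have := hcT x hx
        simp_all
      subst hxv
      obtain ⟨a, ha, b, hb, hxa, hxb, hab⟩ := hc.exists_adj_ne_of_mem_support hx
      have haw : a ≠ w := by rintro rfl; simpa using hcT a ha
      have hbw : b ≠ w := by rintro rfl; simpa using hcT b hb
      have hsub : ({a, b, w} : Finset V) ⊆ G.neighborFinset x := by
        simp [Finset.insert_subset_iff, hxa, hxb, hvw]
      have hcard := Finset.card_le_card hsub
      rw [Finset.card_eq_three.2 ⟨a, b, w, hab, haw, hbw, rfl⟩, card_neighborFinset_eq_degree]
        at hcard
      omega
    · have h₁ := Finset.card_insert_le w (S.erase v)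
      have h₂ := Finset.card_erase_add_one hvS
      omega
  · push Not at hw
    refine ⟨S.erase v, ?_, Finset.card_erase_le, by simp⟩
    rw [isAcyclic_induce_iff]
    intro u c hc
    obtain ⟨x, hx, hxS⟩ := hS c hc
    by_cases hxv : x = v
    · subst hxv
      obtain ⟨a, ha, -, -, hxa, -⟩ := hc.exists_adj_ne_of_mem_support hx
      exact ⟨a, ha, by simp [hw a hxa, hxa.ne']⟩
    · exact ⟨x, hx, by simp_all⟩

end SimpleGraph

/-- If `v` is a vertex of degree at most 2 in a finite simple graph `G`, then `G` has a
feedback vertex set of minimum cardinality (among all feedback vertex sets of `G`)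
that does not contain `v`. -/
theorem exists_min_fvs_not_containing_degree_le_two_vertex
    {V : Type*} [Fintype V] [DecidableEq V]
    (G : SimpleGraph V) [DecidableRel G.Adj]
    (v : V) (hv : G.degree v ≤ 2) :
    ∃ S : Finset V,
      (G.induce ((↑S : Set V)ᶜ)).IsAcyclic ∧
      (∀ T : Finset V, (G.induce ((↑T : Set V)ᶜ)).IsAcyclic → S.card ≤ T.card) ∧
      v ∉ S := by
  have huniv : (G.induce ((↑(Finset.univ : Finset V) : Set V)ᶜ)).IsAcyclic :=
    fun u ↦ absurd u.2 (by simp)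
  obtain ⟨S, hS, hmin⟩ := exists_minimalFor_of_wellFoundedLT
    (fun T : Finset V ↦ (G.induce ((↑T : Set V)ᶜ)).IsAcyclic) Finset.card ⟨_, huniv⟩
  obtain ⟨T, hT, hTS, hvT⟩ := SimpleGraph.exists_isAcyclic_induce_compl_notMem hv hS
  refine ⟨T, hT, fun U hU ↦ hTS.trans ?_, hvT⟩
  exact (le_total S.card U.card).elim id (hmin hU)
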